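/- arXiv:1202.1411 — 2 statements merged into one kernel-verified Lean document; each statement's English description precedes it below -/
import Mathlib

section
/- Let f : Sⁿ → ℝ^{n+1} be a continuous tangent vector field on the n-sphere (i.e., xᵀf(x) = 0 for all x ∈ Sⁿ) satisfying f(x) = f(−x) for all x ∈ Sⁿ. Then f has at least one zero on Sⁿ. -/
open scoped RealInnerProductSpace

/-- The differences between cyclically consecutive vertices of a simplex of the Kuhn triangulation
of `ℝ^ι`: the unit vectors, and the vector leading from the top vertex to the bottom one. -/
def kuhnStep {ι : Type*} [DecidableEq ι] : Option ι → ι → ℤ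
  | none => -1
  | some j => Pi.single j 1

/-- A cyclically ordered list of the vertices of a simplex of the Kuhn triangulation
of `ℝ^{n+1}`. -/
def IsKuhn {n : ℕ} (w : ZMod (n + 2) → Fin (n + 1) → ℤ) : Prop :=
  ∃ ρ : ZMod (n + 2) ≃ Option (Fin (n + 1)), ∀ i, w (i + 1) = w i + kuhnStep (ρ i)

/-- The vertices other than the zeroth one carry all the labels `some c`. -/
def IsDoor {n : ℕ} {V : Type*} (L : V → Option (Fin (n + 1))) (w : ZMod (n + 2) → V) : Prop :=
  ∀ c, ∃ i, i ≠ 0 ∧ L (w i) = some c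

/-- All labels occur, and the zeroth vertex is the one labelled `none`. -/
def IsFull {n : ℕ} {V : Type*} (L : V → Option (Fin (n + 1))) (w : ZMod (n + 2) → V) : Prop :=
  IsDoor L w ∧ L (w 0) = none

/-- Replace the zeroth vertex by its reflection across the opposite facet. -/
def kuhnPivot {n : ℕ} (w : ZMod (n + 2) → Fin (n + 1) → ℤ) : ZMod (n + 2) → Fin (n + 1) → ℤ :=
  Function.update w 0 (w 1 + w (-1) - w 0)

instance ZMod.nontrivial_add_two (n : ℕ) : Nontrivial (ZMod (n + 2)) :=
  inferInstanceAs (Nontrivial (Fin (n + 2)))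

theorem kuhnStep_injective {ι : Type*} [DecidableEq ι] :
    Function.Injective (kuhnStep : Option ι → ι → ℤ) := by
  have key : ∀ j : ι, kuhnStep none ≠ kuhnStep (some j) := fun j h => by
    have := congrFun h j
    simp [kuhnStep] at this
  rintro (_ | a) (_ | b) h
  · rfl
  · exact absurd h (key b)
  · exact absurd h.symm (key a)
  · have := congrFun h a
    by_contra hab
    have hab' : a ≠ b := fun h => hab (by rw [h])
    simp [kuhnStep, Pi.single_eq_of_ne hab'] at this

theorem Finset.even_card_of_involution {α : Type*} (s : Finset α) (g : α → α)
    (hmem : ∀ x ∈ s, g x ∈ s) (hinv : ∀ x ∈ s, g (g x) = x) (hne : ∀ x ∈ s, g x ≠ x) :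
    Even s.card := by
  have h : ∑ _x ∈ s, (1 : ZMod 2) = 0 :=
    Finset.sum_involution (fun x _ => g x) (fun _ _ => by decide) (fun x hx _ => hne x hx)
      hmem hinv
  rw [Finset.sum_const, nsmul_one] at h
  exact (ZMod.natCast_eq_zero_iff_even).1 h

namespace IsKuhn

variable {n : ℕ} {w : ZMod (n + 2) → Fin (n + 1) → ℤ}

theorem rotate (hw : IsKuhn w) (k : ZMod (n + 2)) : IsKuhn fun i => w (i + k) := by
  obtain ⟨ρ, h⟩ := hw
  refine ⟨(Equiv.addRight k).trans ρ, fun i => ?_⟩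
  simpa [add_right_comm] using h (i + k)

theorem reflect (hw : IsKuhn w) : IsKuhn fun i => -w (-i) := by
  obtain ⟨ρ, h⟩ := hw
  refine ⟨((Equiv.neg _).trans (Equiv.subRight 1)).trans ρ, fun i => ?_⟩
  have := h (-i - 1)
  rw [sub_add_cancel] at this
  simp only [Equiv.trans_apply, Equiv.neg_apply, Equiv.subRight_apply]
  rw [this, show -(i + 1) = -i - 1 by ring]
  abel

theorem reflect_ne (hw : IsKuhn w) : (fun i => -w (-i)) ≠ w := by
  obtain ⟨ρ, h⟩ := hw
  intro heq
  have h0 : w 0 = 0 := by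
    have := congrFun heq 0
    simp only [neg_zero] at this
    funext j
    have := congrFun this j
    simp only [Pi.neg_apply, Pi.zero_apply] at this ⊢
    omega
  have h1 := h 0
  have h2 := h (-1)
  have h3 : -w (-1) = w 1 := congrFun heq 1
  rw [neg_add_cancel, h0] at h2
  rw [zero_add, h0, zero_add, ← h3, neg_eq_of_add_eq_zero_right h2.symm] at h1
  have := ρ.injective (kuhnStep_injective h1)
  simp at this

theorem pivot (hw : IsKuhn w) : IsKuhn (kuhnPivot w) := by
  obtain ⟨ρ, h⟩ := hw
  refine ⟨(Equiv.swap (-1) 0).trans ρ, fun i => ?_⟩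
  have h0 := h 0
  have h1 := h (-1)
  rw [zero_add] at h0
  rw [neg_add_cancel] at h1
  unfold kuhnPivot
  by_cases hi0 : i = 0
  · subst hi0
    simp [h1]
    abel
  by_cases hi1 : i = -1
  · subst hi1
    rw [neg_add_cancel, Function.update_self, Function.update_of_ne hi0, h0, Equiv.trans_apply,
      Equiv.swap_apply_left]
    abel
  · have hi2 : i + 1 ≠ 0 := fun h => hi1 (eq_neg_of_add_eq_zero_left h)
    simpa [hi0, hi2, Equiv.swap_apply_of_ne_of_ne hi1 hi0] using h i

theorem pivot_ne (hw : IsKuhn w) : kuhnPivot w ≠ w := by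
  obtain ⟨ρ, h⟩ := hw
  intro heq
  have h0 := h 0
  have h1 := h (-1)
  rw [zero_add] at h0
  rw [neg_add_cancel] at h1
  have h2 : w 1 + w (-1) - w 0 = w 0 := by simpa [kuhnPivot] using congrFun heq 0
  have h3 : kuhnStep (ρ 0) = kuhnStep (ρ (-1)) := by
    have e0 : kuhnStep (ρ 0) = w 1 - w 0 := by rw [h0]; abel
    have e1 : kuhnStep (ρ (-1)) = w 0 - w (-1) := eq_sub_of_add_eq' h1.symm
    rw [e0, e1, sub_eq_sub_iff_add_eq_add, ← sub_eq_iff_eq_add, h2]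
  have := ρ.injective (kuhnStep_injective h3)
  simp at this

/-- In each coordinate, the vertices climb by one unit from the bottom vertex to the top one. -/
theorem exists_chain (hw : IsKuhn w) : ∃ (b : Fin (n + 1) → ℤ) (t : Fin (n + 1) → ℕ)
    (m : ZMod (n + 2) → ℕ), ∀ i j, w i j = b j + if t j < m i then 1 else 0 := by
  obtain ⟨ρ, h⟩ := hw
  set k := ρ.symm none + 1 with hk
  have key : ∀ m : ℕ, m ≤ n + 1 → ∀ j,
      w (k + m) j = w k j + if (ρ.symm (some j) - k).val < m then 1 else 0 := by
    intro m
    induction m with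
    | zero => simp
    | succ m ih =>
      intro hm j
      have hval : ((m : ZMod (n + 2))).val = m := ZMod.val_natCast_of_lt (by omega)
      have hj : (ρ.symm (some j) - k).val = m ↔ ρ (k + m) = some j := by
        rw [← Equiv.eq_symm_apply, ← eq_sub_iff_add_eq', ← (ZMod.val_injective (n + 2)).eq_iff,
          hval, eq_comm]
      have hnone : ρ (k + m) ≠ none := by
        rw [Ne, ← Equiv.eq_symm_apply, hk]
        intro heq
        have h0 : ((m + 1 : ℕ) : ZMod (n + 2)) = 0 := by
          push_cast
          linear_combination heq
        rw [ZMod.natCast_eq_zero_iff] at h0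
        have := Nat.le_of_dvd (by omega) h0
        omega
      obtain ⟨c, hc⟩ := Option.ne_none_iff_exists'.1 hnone
      have hstep := congrFun (h (k + m)) j
      push_cast
      rw [← add_assoc, hstep, Pi.add_apply, ih (by omega) j, hc]
      rw [hc] at hj
      by_cases hjc : j = c
      · subst hjc
        have := hj.2 rfl
        simp [kuhnStep, this]
      · have hne : (ρ.symm (some j) - k).val ≠ m := fun h => hjc (Option.some.inj (hj.1 h)).symm
        have hiff : (ρ.symm (some j) - k).val < m + 1 ↔ (ρ.symm (some j) - k).val < m := by omega
        simp [kuhnStep, hjc, hiff]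
  refine ⟨w k, fun j => (ρ.symm (some j) - k).val, fun i => (i - k).val, fun i j => ?_⟩
  have hlt := ZMod.val_lt (i - k)
  have := key (i - k).val (by omega) j
  rwa [ZMod.natCast_zmod_val, add_sub_cancel] at this

theorem le_add_one (hw : IsKuhn w) (i i' : ZMod (n + 2)) (j : Fin (n + 1)) :
    w i j ≤ w i' j + 1 := by
  obtain ⟨b, t, m, h⟩ := hw.exists_chain
  rw [h, h]
  split_ifs <;> omega

theorem sum_eq (hw : IsKuhn w) (i : ZMod (n + 2)) :
    ((∑ j, w i j : ℤ) : ZMod (n + 2)) = ((∑ j, w 0 j : ℤ) : ZMod (n + 2)) + i := by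
  obtain ⟨ρ, h⟩ := hw
  have hstep : ∀ o : Option (Fin (n + 1)),
      ((∑ j, kuhnStep o j : ℤ) : ZMod (n + 2)) = 1 := by
    rintro (_ | c)
    · have h0 : ((n + 2 : ℕ) : ZMod (n + 2)) = 0 := ZMod.natCast_self _
      push_cast at h0
      simp [kuhnStep]
      linear_combination -h0
    · simp [kuhnStep]
  have key : ∀ m : ℕ, ((∑ j, w (m : ZMod (n + 2)) j : ℤ) : ZMod (n + 2)) =
      ((∑ j, w 0 j : ℤ) : ZMod (n + 2)) + m := by
    intro m
    induction m with
    | zero => simp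
    | succ m ih =>
      rw [Nat.cast_succ, h]
      simp only [Pi.add_apply, Finset.sum_add_distrib]
      rw [Int.cast_add, ih, hstep]
      ring
  simpa using key i.val

theorem injective (hw : IsKuhn w) : Function.Injective w := fun i i' h => by
  have h1 := hw.sum_eq i
  rw [h, hw.sum_eq i'] at h1
  exact (add_left_cancel h1).symm

end IsKuhn

theorem kuhnPivot_of_ne {n : ℕ} (w : ZMod (n + 2) → Fin (n + 1) → ℤ) {i : ZMod (n + 2)}
    (hi : i ≠ 0) : kuhnPivot w i = w i := by
  simp [kuhnPivot, hi]

theorem kuhnPivot_kuhnPivot {n : ℕ} (w : ZMod (n + 2) → Fin (n + 1) → ℤ) :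
    kuhnPivot (kuhnPivot w) = w := by
  have h : (-1 : ZMod (n + 2)) ≠ 0 := neg_ne_zero.2 one_ne_zero
  simp [kuhnPivot, h]

theorem isDoor_kuhnPivot {n : ℕ} (L : (Fin (n + 1) → ℤ) → Option (Fin (n + 1)))
    (w : ZMod (n + 2) → Fin (n + 1) → ℤ) : IsDoor L (kuhnPivot w) ↔ IsDoor L w := by
  refine forall_congr' fun c => exists_congr fun i => and_congr_right fun hi => ?_
  rw [kuhnPivot_of_ne w hi]

theorem IsDoor.injOn {n : ℕ} {V : Type*} {L : V → Option (Fin (n + 1))} {w : ZMod (n + 2) → V}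
    (h : IsDoor L w) {i i' : ZMod (n + 2)} (hi : i ≠ 0) (hi' : i' ≠ 0)
    (heq : L (w i) = L (w i')) : i = i' := by
  classical
  have hsub : (Finset.univ : Finset (Fin (n + 1))).image some ⊆
      ((Finset.univ : Finset (ZMod (n + 2))).erase 0).image fun i => L (w i) := by
    intro o ho
    obtain ⟨c, -, rfl⟩ := Finset.mem_image.1 ho
    obtain ⟨i, hi, hc⟩ := h c
    exact Finset.mem_image.2 ⟨i, by simp [hi], hc⟩
  have hcard : ((Finset.univ : Finset (ZMod (n + 2))).erase 0).card = n + 1 := by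
    simp [ZMod.card]
  have hle := Finset.card_le_card hsub
  rw [Finset.card_image_of_injective _ (Option.some_injective _), Finset.card_univ,
    Fintype.card_fin] at hle
  have hinj := Finset.card_image_iff.1 (le_antisymm Finset.card_image_le (hcard.trans_le hle))
  exact hinj (by simp [hi]) (by simp [hi']) heq

theorem finite_isKuhn {n : ℕ} {S : Set (Fin (n + 1) → ℤ)} (hS : S.Finite) :
    {w : ZMod (n + 2) → Fin (n + 1) → ℤ | IsKuhn w ∧ ∃ i, w i ∈ S}.Finite := by
  obtain ⟨a, ha⟩ := hS.bddBelow
  obtain ⟨b, hb⟩ := hS.bddAbove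
  refine (Set.finite_Icc (fun _ => a - 1) (fun _ => b + 1)).subset ?_
  rintro w ⟨hw, i, hi⟩
  refine ⟨fun i' j => ?_, fun i' j => ?_⟩
  · have h1 := hw.le_add_one i i' j
    have h2 : a j ≤ w i j := ha hi j
    simp only [Pi.sub_apply, Pi.one_apply]
    omega
  · have h1 := hw.le_add_one i' i j
    have h2 : w i j ≤ b j := hb hi j
    simp only [Pi.add_apply, Pi.one_apply]
    omega

open Classical in
/-- Doors whose zeroth label is not `none` are matched by rotation. -/
theorem even_card_isDoor_not_isFull {n : ℕ} (L : (Fin (n + 1) → ℤ) → Option (Fin (n + 1)))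
    (T : Finset (ZMod (n + 2) → Fin (n + 1) → ℤ)) (hT : ∀ w ∈ T, IsKuhn w)
    (hrotate : ∀ w ∈ T, ∀ k, (fun i => w (i + k)) ∈ T) :
    Even (T.filter fun w => IsDoor L w ∧ ¬IsFull L w).card := by
  have hex : ∀ w : ZMod (n + 2) → Fin (n + 1) → ℤ, ∃ k, IsDoor L w ∧ ¬IsFull L w →
      k ≠ 0 ∧ L (w k) = L (w 0) := by
    intro w
    by_cases hw : IsDoor L w ∧ ¬IsFull L w
    · obtain ⟨c, hc⟩ := Option.ne_none_iff_exists'.1 fun h => hw.2 ⟨hw.1, h⟩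
      obtain ⟨k, hk, hkc⟩ := hw.1 c
      exact ⟨k, fun _ => ⟨hk, hkc.trans hc.symm⟩⟩
    · exact ⟨0, fun h => absurd h hw⟩
  choose κ hκ using hex
  have hrot : ∀ w, IsDoor L w ∧ ¬IsFull L w →
      IsDoor L (fun i => w (i + κ w)) ∧ ¬IsFull L (fun i => w (i + κ w)) := by
    intro w hw
    obtain ⟨h0, hL⟩ := hκ w hw
    refine ⟨fun c => ?_, fun hf => hw.2 ⟨hw.1, ?_⟩⟩
    · obtain ⟨i, hi, hc⟩ := hw.1 c
      by_cases hik : i = κ w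
      · refine ⟨-κ w, neg_ne_zero.2 h0, ?_⟩
        rw [hik, hL] at hc
        simpa using hc
      · exact ⟨i - κ w, sub_ne_zero.2 hik, by simpa using hc⟩
    · rw [← hL, ← zero_add (κ w)]
      exact hf.2
  have hκrot : ∀ w, IsDoor L w ∧ ¬IsFull L w → κ (fun i => w (i + κ w)) = -κ w := by
    intro w hw
    obtain ⟨h0, hL⟩ := hκ w hw
    obtain ⟨h0', hL'⟩ := hκ _ (hrot w hw)
    refine (hrot w hw).1.injOn h0' (neg_ne_zero.2 h0) ?_
    rw [hL', zero_add, neg_add_cancel, hL]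
  refine Finset.even_card_of_involution _ (fun w i => w (i + κ w)) ?_ ?_ ?_
  · intro w hw
    rw [Finset.mem_filter] at hw ⊢
    exact ⟨hrotate w hw.1 _, hrot w hw.2⟩
  · intro w hw
    rw [Finset.mem_filter] at hw
    funext i
    simp [hκrot w hw.2]
  · intro w hw heq
    rw [Finset.mem_filter] at hw
    exact (hκ w hw.2).1 ((hT w hw.1).injective (by simpa using congrFun heq 0))

open Classical in
/-- The parity of the number of full simplices does not change when finitely many labels do. -/
theorem even_card_isFull_add {n : ℕ} (L L' : (Fin (n + 1) → ℤ) → Option (Fin (n + 1)))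
    {S : Set (Fin (n + 1) → ℤ)} (hS : S.Finite) (hL : ∀ x, x ∉ S → L x = L' x) :
    Even (((finite_isKuhn hS).toFinset.filter (IsFull L)).card +
      ((finite_isKuhn hS).toFinset.filter (IsFull L')).card) := by
  set T := (finite_isKuhn hS).toFinset with hTdef
  have hT : ∀ w, w ∈ T ↔ IsKuhn w ∧ ∃ i, w i ∈ S := fun w => by simp [hTdef]
  have hdoor : Even (T.filter fun w => ¬(IsDoor L w ↔ IsDoor L' w)).card := by
    refine Finset.even_card_of_involution _ kuhnPivot ?_ (fun w _ => kuhnPivot_kuhnPivot w) ?_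
    · intro w hw
      rw [Finset.mem_filter, hT] at hw ⊢
      rw [isDoor_kuhnPivot, isDoor_kuhnPivot]
      refine ⟨⟨hw.1.1.pivot, ?_⟩, hw.2⟩
      by_contra! hno
      refine hw.2 (forall_congr' fun c => exists_congr fun i => and_congr_right fun hi => ?_)
      rw [hL (w i) (kuhnPivot_of_ne w hi ▸ hno i)]
    · intro w hw
      rw [Finset.mem_filter, hT] at hw
      exact hw.1.1.pivot_ne
  have hrot : ∀ w ∈ T, ∀ k, (fun i => w (i + k)) ∈ T := by
    intro w hw k
    rw [hT] at hw ⊢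
    obtain ⟨i, hi⟩ := hw.2
    exact ⟨hw.1.rotate k, i - k, by simpa using hi⟩
  have hfull : ∀ L : (Fin (n + 1) → ℤ) → Option (Fin (n + 1)),
      Even ((T.filter (IsFull L)).card + (T.filter (IsDoor L)).card) := by
    intro L
    have h := Finset.card_filter_add_card_filter_not (s := T.filter (IsDoor L)) (IsFull L)
    rw [Finset.filter_filter, Finset.filter_filter] at h
    have h1 : (T.filter fun w => IsDoor L w ∧ IsFull L w) = T.filter (IsFull L) :=
      Finset.filter_congr fun w _ => ⟨And.right, fun h => ⟨h.1, h⟩⟩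
    have h2 := even_card_isDoor_not_isFull L T (fun w hw => ((hT w).1 hw).1) hrot
    rw [h1] at h
    rw [← h, ← add_assoc]
    exact (Even.add_self _).add h2
  have hsplit : (T.filter (IsDoor L)).card + (T.filter (IsDoor L')).card =
      (T.filter fun w => ¬(IsDoor L w ↔ IsDoor L' w)).card +
        2 * (T.filter fun w => IsDoor L w ∧ IsDoor L' w).card := by
    simp only [Finset.card_filter, Finset.mul_sum, ← Finset.sum_add_distrib]
    refine Finset.sum_congr rfl fun w _ => ?_
    by_cases h1 : IsDoor L w <;> by_cases h2 : IsDoor L' w <;> simp [h1, h2]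
  have h1 := hfull L
  have h2 := hfull L'
  grind

/-- The first negative coordinate. -/
noncomputable def firstNeg {n : ℕ} (y : Fin n → ℝ) : Option (Fin n) :=
  open Classical in if h : ∃ c, y c < 0 ∧ ∀ j < c, 0 ≤ y j then some h.choose else none

theorem firstNeg_eq_some {n : ℕ} {y : Fin n → ℝ} {c : Fin n} :
    firstNeg y = some c ↔ y c < 0 ∧ ∀ j < c, 0 ≤ y j := by
  constructor
  · intro h
    unfold firstNeg at h
    split_ifs at h with hex
    exact Option.some.inj h ▸ hex.choose_spec
  · intro h
    have hex : ∃ c, y c < 0 ∧ ∀ j < c, 0 ≤ y j := ⟨c, h⟩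
    rw [firstNeg, dif_pos hex, Option.some.injEq]
    have hs := hex.choose_spec
    rcases lt_trichotomy hex.choose c with hlt | heq | hlt
    · exact absurd hs.1 (h.2 _ hlt).not_gt
    · exact heq
    · exact absurd h.1 (hs.2 _ hlt).not_gt

theorem firstNeg_eq_none {n : ℕ} {y : Fin n → ℝ} : firstNeg y = none ↔ ∀ j, 0 ≤ y j := by
  constructor
  · intro h
    by_contra! hex
    obtain ⟨c, hc⟩ := hex
    obtain ⟨c, hc, hmin⟩ := WellFounded.has_min (wellFounded_lt (α := Fin n)) {c | y c < 0} ⟨c, hc⟩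
    have := firstNeg_eq_some.2 ⟨hc, fun j hj => not_lt.1 fun hneg => hmin j hneg hj⟩
    rw [h] at this
    cases this
  · intro h
    rw [Option.eq_none_iff_forall_ne_some]
    intro c hc
    exact absurd (firstNeg_eq_some.1 hc).1 (h c).not_gt

theorem firstNeg_div {n : ℕ} (y : Fin n → ℝ) {a : ℝ} (ha : 0 < a) :
    firstNeg (fun j => y j / a) = firstNeg y := by
  cases h : firstNeg y with
  | none => simpa [firstNeg_eq_none, le_div_iff₀ ha] using h
  | some c => simpa [firstNeg_eq_some, le_div_iff₀ ha, div_lt_iff₀ ha] using h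

/-- The cyclic order on the vertices of `cornerSimplex`. -/
def cornerIndex (n : ℕ) : ZMod (n + 2) ≃ Option (Fin (n + 1)) :=
  finSuccEquiv (n + 1)

/-- The unique simplex that is full for the labelling `firstNeg`. -/
def cornerSimplex (n : ℕ) (i : ZMod (n + 2)) (j : Fin (n + 1)) : ℤ :=
  match cornerIndex n i with
  | none => 0
  | some c => if j < c then 0 else -1

theorem cornerIndex_symm_none (n : ℕ) : (cornerIndex n).symm none = 0 := rfl

theorem cornerIndex_symm_some (n : ℕ) (c : Fin (n + 1)) :
    (cornerIndex n).symm (some c) = (c : ℕ) + 1 := by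
  apply ZMod.val_injective
  rw [← Nat.cast_succ, ZMod.val_natCast_of_lt (by omega)]
  rfl

theorem cornerSimplex_zero (n : ℕ) : cornerSimplex n 0 = 0 := rfl

theorem cornerSimplex_symm_some (n : ℕ) (c j : Fin (n + 1)) :
    cornerSimplex n ((cornerIndex n).symm (some c)) j = if j < c then 0 else -1 := by
  simp [cornerSimplex]

theorem isKuhn_cornerSimplex (n : ℕ) : IsKuhn (cornerSimplex n) := by
  refine ⟨cornerIndex n, fun i => ?_⟩
  obtain ⟨o, rfl⟩ := (cornerIndex n).symm.surjective i
  rw [Equiv.apply_symm_apply]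
  funext j
  rw [Pi.add_apply]
  rcases o with _ | c
  · have h1 : (cornerIndex n).symm none + 1 = (cornerIndex n).symm (some 0) := by
      simp [cornerIndex_symm_none, cornerIndex_symm_some]
    rw [h1, cornerSimplex_symm_some, cornerIndex_symm_none, cornerSimplex_zero]
    simp [kuhnStep]
  · rw [cornerSimplex_symm_some]
    induction c using Fin.lastCases with
    | last =>
      have h1 : (cornerIndex n).symm (some (Fin.last n)) + 1 = 0 := by
        have h0 : ((n + 2 : ℕ) : ZMod (n + 2)) = 0 := ZMod.natCast_self _
        push_cast at h0
        rw [cornerIndex_symm_some, Fin.val_last]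
        linear_combination h0
      rw [h1, cornerSimplex_zero]
      by_cases hj : j = Fin.last n
      · simp [hj, kuhnStep]
      · have := Fin.lt_last_iff_ne_last.2 hj
        simp [hj, this, kuhnStep]
    | cast c =>
      have h1 : (cornerIndex n).symm (some c.castSucc) + 1 =
          (cornerIndex n).symm (some c.succ) := by
        simp [cornerIndex_symm_some]
      rw [h1, cornerSimplex_symm_some]
      rcases lt_trichotomy j c.castSucc with h | h | h
      · have h2 : j < c.succ := h.trans (Fin.castSucc_lt_succ)
        simp [h, h2, kuhnStep, h.ne]
      · subst h
        simp [kuhnStep]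
      · have h2 : ¬ j < c.succ := not_lt.2 (Fin.castSucc_lt_iff_succ_le.1 h)
        simp [h2, kuhnStep, h.ne', h.not_gt]

theorem isFull_cornerSimplex (n : ℕ) :
    IsFull (fun x : Fin (n + 1) → ℤ => firstNeg fun j => (x j : ℝ)) (cornerSimplex n) := by
  refine ⟨fun c => ⟨(cornerIndex n).symm (some c), ?_, ?_⟩, ?_⟩
  · rw [← cornerIndex_symm_none]
    simp
  · refine firstNeg_eq_some.2 ⟨?_, fun j hj => ?_⟩
    · simp [cornerSimplex_symm_some]
    · simp [cornerSimplex_symm_some, hj]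
  · simp [firstNeg_eq_none, cornerSimplex_zero]

theorem IsKuhn.eq_cornerSimplex {n : ℕ} {w : ZMod (n + 2) → Fin (n + 1) → ℤ} (hw : IsKuhn w)
    (hfull : IsFull (fun x : Fin (n + 1) → ℤ => firstNeg fun j => (x j : ℝ)) w) :
    w = cornerSimplex n := by
  obtain ⟨b, t, m, h⟩ := hw.exists_chain
  have h0 : ∀ j, 0 ≤ w 0 j := fun j => by exact_mod_cast firstNeg_eq_none.1 hfull.2 j
  have hb : ∀ j, b j = -1 := by
    intro j
    obtain ⟨i, -, hi⟩ := hfull.1 j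
    have h1 : w i j < 0 := by exact_mod_cast (firstNeg_eq_some.1 hi).1
    have h2 := h0 j
    rw [h] at h1 h2
    split_ifs at h1 h2 <;> omega
  have hle : ∀ i j, w i j ≤ 0 := by
    intro i j
    rw [h, hb]
    split_ifs <;> omega
  have hmem : ∀ i, ∃ k, w i = cornerSimplex n k := by
    intro i
    cases hi : firstNeg fun j => (w i j : ℝ) with
    | none =>
      refine ⟨0, ?_⟩
      rw [cornerSimplex_zero]
      funext j
      exact le_antisymm (hle i j) (by exact_mod_cast firstNeg_eq_none.1 hi j)
    | some c =>
      refine ⟨(cornerIndex n).symm (some c), ?_⟩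
      funext j
      rw [cornerSimplex_symm_some]
      have hi' := firstNeg_eq_some.1 hi
      have hc : w i c < 0 := by exact_mod_cast hi'.1
      split_ifs with hj
      · exact le_antisymm (hle i j) (by exact_mod_cast hi'.2 j hj)
      · obtain ⟨i', -, hj'⟩ := hfull.1 j
        have hj' := firstNeg_eq_some.1 hj'
        have h1 : w i' j < 0 := by exact_mod_cast hj'.1
        rcases (not_lt.1 hj).eq_or_lt with rfl | hcj
        · rw [h, hb] at hc ⊢
          split_ifs at hc ⊢ <;> omega
        · have h2 : 0 ≤ w i' c := by exact_mod_cast hj'.2 c hcj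
          rw [h, hb] at h1 h2 hc ⊢
          split_ifs at h1 h2 hc ⊢ <;> omega
  have hw0 : w 0 = 0 := funext fun j => le_antisymm (hle 0 j) (h0 j)
  funext i
  obtain ⟨k, hk⟩ := hmem i
  have h1 := hw.sum_eq i
  have h2 := (isKuhn_cornerSimplex n).sum_eq k
  rw [hw0, hk] at h1
  rw [cornerSimplex_zero] at h2
  rw [hk, add_left_cancel (h1.symm.trans h2)]

/-- A labelling that agrees with the standard one outside a finite set has a full simplex on which
it is not even. -/
theorem exists_isFull_not_even {n : ℕ} (L : (Fin (n + 1) → ℤ) → Option (Fin (n + 1)))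
    {S : Set (Fin (n + 1) → ℤ)} (hS : S.Finite) (hneg : ∀ x ∈ S, -x ∈ S) (h0 : 0 ∈ S)
    (hL : ∀ x, x ∉ S → L x = firstNeg fun j => (x j : ℝ)) :
    ∃ w, IsKuhn w ∧ (∃ i, w i ∈ S) ∧ IsFull L w ∧ ∃ i, L (-w i) ≠ L (w i) := by
  classical
  by_contra! hno
  have hpar := even_card_isFull_add L _ hS hL
  have hone : (finite_isKuhn hS).toFinset.filter
      (IsFull fun x : Fin (n + 1) → ℤ => firstNeg fun j => (x j : ℝ)) = {cornerSimplex n} := by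
    ext w
    simp only [Finset.mem_filter, Set.Finite.mem_toFinset, Set.mem_ofPred_eq,
      Finset.mem_singleton]
    constructor
    · rintro ⟨⟨hw, -⟩, hf⟩
      exact hw.eq_cornerSimplex hf
    · rintro rfl
      exact ⟨⟨isKuhn_cornerSimplex n, 0, by rwa [cornerSimplex_zero]⟩, isFull_cornerSimplex n⟩
  have heven : Even ((finite_isKuhn hS).toFinset.filter (IsFull L)).card := by
    refine Finset.even_card_of_involution _ (fun w i => -w (-i)) ?_ (by simp) ?_
    · intro w hw
      simp only [Finset.mem_filter, Set.Finite.mem_toFinset, Set.mem_ofPred_eq] at hw ⊢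
      obtain ⟨⟨hk, i, hi⟩, hf⟩ := hw
      have hev := hno w hk ⟨i, hi⟩ hf
      refine ⟨⟨hk.reflect, -i, by simpa using hneg _ hi⟩, fun c => ?_, ?_⟩
      · obtain ⟨i, hi, hc⟩ := hf.1 c
        exact ⟨-i, neg_ne_zero.2 hi, by simpa [hev] using hc⟩
      · simpa [hev] using hf.2
    · intro w hw
      simp only [Finset.mem_filter, Set.Finite.mem_toFinset, Set.mem_ofPred_eq] at hw
      exact hw.1.1.reflect_ne
  rw [hone, Finset.card_singleton] at hpar
  grind

/-- A continuous map that is the identity near infinity and even near the origin has a zero away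
from the origin. -/
theorem exists_zero_of_even_near_zero {n : ℕ} (F : (Fin (n + 1) → ℝ) → Fin (n + 1) → ℝ)
    (hF : ContinuousOn F {0}ᶜ) (R : ℕ) (hid : ∀ x, (R : ℝ) ≤ ‖x‖ → F x = x) {r : ℝ} (hr : 0 < r)
    (heven : ∀ x, ‖x‖ ≤ r → F (-x) = F x) : ∃ x, x ≠ 0 ∧ F x = 0 := by
  by_contra! hne
  set K : Set (Fin (n + 1) → ℝ) := Metric.closedBall 0 (R + 1) \ Metric.ball 0 (r / 2) with hKdef
  have hK : IsCompact K := (isCompact_closedBall _ _).diff Metric.isOpen_ball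
  have hK0 : K ⊆ {0}ᶜ := by
    rintro x hx rfl
    exact hx.2 (Metric.mem_ball_self (by positivity))
  have hcont : ContinuousOn F K := hF.mono hK0
  obtain ⟨δ, hδ, hδK⟩ : ∃ δ > 0, ∀ x ∈ K, δ ≤ ‖F x‖ :=
    hK.exists_forall_le' hcont.norm fun x hx => norm_pos_iff.2 (hne x (hK0 hx))
  obtain ⟨η, hη, huc⟩ := Metric.uniformContinuousOn_iff.1
    (hK.uniformContinuousOn_of_continuous hcont) δ hδ
  obtain ⟨N, hN⟩ := exists_nat_one_div_lt (show 0 < min η (min (r / 2) 1) by positivity)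
  set a : ℝ := N + 1 with ha
  have ha0 : 0 < a := by positivity
  obtain ⟨hNη, hNr, hN1⟩ : 1 / a < η ∧ 1 / a < r / 2 ∧ 1 / a < 1 := by
    simpa only [lt_min_iff] using hN
  let p : (Fin (n + 1) → ℤ) → Fin (n + 1) → ℝ := fun x j => x j / a
  have hpneg : ∀ x, p (-x) = -p x := fun x => by
    funext j
    simp [p, neg_div]
  let B : ℤ := R * (N + 1)
  have hB : (B : ℝ) = R * a := by simp [B, ha]
  let S : Set (Fin (n + 1) → ℤ) := Set.Icc (fun _ => -B) fun _ => B
  have hB0 : 0 ≤ B := by positivity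
  obtain ⟨w, hw, ⟨i₀, hi₀⟩, hfull, i₁, hi₁⟩ := exists_isFull_not_even (fun x => firstNeg (F (p x)))
    (S := S) (Set.finite_Icc _ _)
    (fun x hx => ⟨fun j => neg_le_neg (hx.2 j), fun j => neg_le.1 (hx.1 j)⟩)
    ⟨fun _ => neg_nonpos.2 hB0, fun _ => hB0⟩
    (by
      intro x hx
      have hnorm : (R : ℝ) ≤ ‖p x‖ := by
        by_contra! hlt
        refine hx ?_
        have : ∀ j, |x j| ≤ B := by
          intro j
          have h1 := (norm_le_pi_norm (p x) j).trans hlt.le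
          rw [Real.norm_eq_abs, abs_div, abs_of_pos ha0, div_le_iff₀ ha0, ← hB] at h1
          exact_mod_cast h1
        exact ⟨fun j => (abs_le.1 (this j)).1, fun j => (abs_le.1 (this j)).2⟩
      change firstNeg (F (p x)) = _
      rw [hid _ hnorm]
      exact firstNeg_div _ ha0)
  have hdist : ∀ i i', dist (p (w i)) (p (w i')) ≤ 1 / a := by
    intro i i'
    refine (dist_pi_le_iff (by positivity)).2 fun j => ?_
    rw [Real.dist_eq, ← sub_div, abs_div, abs_of_pos ha0]
    gcongr
    have h1 := hw.le_add_one i i' j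
    have h2 := hw.le_add_one i' i j
    have h3 : |w i j - w i' j| ≤ 1 := abs_le.2 ⟨by omega, by omega⟩
    exact_mod_cast h3
  have hnorm : ∀ i i', ‖p (w i)‖ ≤ ‖p (w i')‖ + 1 / a := fun i i' => by
    have := norm_le_norm_add_norm_sub' (p (w i)) (p (w i'))
    have h := hdist i i'
    rw [dist_eq_norm] at h
    linarith
  have hsmall : ∀ i, ‖p (w i)‖ ≤ r := by
    by_contra! hbig
    obtain ⟨i₂, hi₂⟩ := hbig
    have hR : ‖p (w i₀)‖ ≤ R := by
      refine (pi_norm_le_iff_of_nonneg (by positivity)).2 fun j => ?_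
      rw [Real.norm_eq_abs, abs_div, abs_of_pos ha0, div_le_iff₀ ha0, ← hB]
      exact_mod_cast abs_le.2 ⟨hi₀.1 j, hi₀.2 j⟩
    have hmem : ∀ i, p (w i) ∈ K := by
      intro i
      have h1 := hnorm i i₀
      have h2 := hnorm i₂ i
      refine ⟨?_, ?_⟩
      · rw [mem_closedBall_zero_iff]
        linarith
      · rw [mem_ball_zero_iff]
        linarith
    refine (hδK _ (hmem 0)).not_gt ((pi_norm_lt_iff hδ).2 fun c => ?_)
    obtain ⟨i, -, hi⟩ := hfull.1 c
    have h1 := (firstNeg_eq_some.1 hi).1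
    have h2 := firstNeg_eq_none.1 hfull.2 c
    have h3 := (dist_le_pi_dist _ _ c).trans_lt
      (huc _ (hmem 0) _ (hmem i) ((hdist 0 i).trans_lt hNη))
    rw [Real.dist_eq] at h3
    rw [Real.norm_eq_abs, abs_of_nonneg h2]
    linarith [le_abs_self (F (p (w 0)) c - F (p (w i)) c)]
  refine hi₁ ?_
  rw [hpneg, heven _ (hsmall i₁)]

/-- An even continuous tangent vector field on the sphere `Sⁿ ⊂ ℝ^{n+1}` has a zero. -/
theorem stmt2 {n : ℕ}
    (f : EuclideanSpace ℝ (Fin (n + 1)) → EuclideanSpace ℝ (Fin (n + 1)))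
    (hf : ContinuousOn f (Metric.sphere (0 : EuclideanSpace ℝ (Fin (n + 1))) 1))
    (htangent : ∀ x ∈ Metric.sphere (0 : EuclideanSpace ℝ (Fin (n + 1))) 1, ⟪x, f x⟫ = 0)
    (heven : ∀ x ∈ Metric.sphere (0 : EuclideanSpace ℝ (Fin (n + 1))) 1, f (-x) = f x) :
    ∃ x ∈ Metric.sphere (0 : EuclideanSpace ℝ (Fin (n + 1))) 1, f x = 0 := by
  let e := EuclideanSpace.equiv (Fin (n + 1)) ℝ
  let H : EuclideanSpace ℝ (Fin (n + 1)) → EuclideanSpace ℝ (Fin (n + 1)) := fun x =>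
    min 1 (max 0 (‖x‖ - 1)) • x + max 0 (2 - ‖x‖) • f (‖x‖⁻¹ • x)
  have hsph : ∀ x : EuclideanSpace ℝ (Fin (n + 1)), x ≠ 0 →
      ‖x‖⁻¹ • x ∈ Metric.sphere (0 : EuclideanSpace ℝ (Fin (n + 1))) 1 := by
    intro x hx
    rw [mem_sphere_zero_iff_norm, norm_smul, norm_inv, norm_norm,
      inv_mul_cancel₀ (norm_ne_zero_iff.2 hx)]
  have hH : ContinuousOn H {0}ᶜ := by
    have h1 : ContinuousOn (fun x : EuclideanSpace ℝ (Fin (n + 1)) => f (‖x‖⁻¹ • x)) {0}ᶜ :=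
      hf.comp ((continuousOn_id.norm.inv₀ fun x hx => norm_ne_zero_iff.2 hx).smul continuousOn_id)
        fun x hx => hsph x hx
    have h2 : Continuous fun x : EuclideanSpace ℝ (Fin (n + 1)) =>
        min 1 (max 0 (‖x‖ - 1)) • x := by fun_prop
    have h3 : Continuous fun x : EuclideanSpace ℝ (Fin (n + 1)) => max 0 (2 - ‖x‖) := by fun_prop
    exact h2.continuousOn.add (h3.continuousOn.smul h1)
  have hle : ∀ x, ‖e x‖ ≤ ‖x‖ := fun x =>
    (pi_norm_le_iff_of_nonneg (norm_nonneg x)).2 fun j => PiLp.norm_apply_le x j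
  obtain ⟨r, hr, hball⟩ : ∃ r > 0, ∀ y, ‖y‖ ≤ r → ‖e.symm y‖ ≤ 1 := by
    have h : Filter.Tendsto (fun y => ‖e.symm y‖) (nhds 0) (nhds 0) := by
      simpa using (e.symm.continuous.norm).tendsto 0
    obtain ⟨r, hr, hb⟩ := Metric.nhds_basis_closedBall.eventually_iff.1
      (h.eventually (ge_mem_nhds one_pos))
    exact ⟨r, hr, fun y hy => hb (by simpa using hy)⟩
  obtain ⟨y, hy, hFy⟩ := exists_zero_of_even_near_zero (fun y => e (H (e.symm y)))
    (e.continuous.comp_continuousOn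
      (hH.comp e.symm.continuous.continuousOn fun y hy => by simpa using hy)) 2
    (by
      intro y hy
      have h2 : 2 ≤ ‖e.symm y‖ := by
        have := hle (e.symm y)
        rw [e.apply_symm_apply] at this
        exact le_trans (by exact_mod_cast hy) this
      simp only [H]
      rw [max_eq_left (show 2 - ‖e.symm y‖ ≤ 0 by linarith), min_eq_left
        (le_max_of_le_right (by linarith)), one_smul, zero_smul, add_zero, e.apply_symm_apply])
    hr
    (by
      intro y hy
      have h1 := hball y hy
      simp only [H, map_neg, norm_neg]
      rw [max_eq_left (show ‖e.symm y‖ - 1 ≤ 0 by linarith), min_eq_right zero_le_one, zero_smul,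
        zero_smul, smul_neg]
      by_cases hy0 : e.symm y = 0
      · simp [hy0]
      · rw [heven _ (hsph _ hy0)])
  set x := e.symm y with hx
  have hx0 : x ≠ 0 := by simpa [hx] using hy
  have hHx : H x = 0 := by simpa using hFy
  refine ⟨‖x‖⁻¹ • x, hsph x hx0, ?_⟩
  have hnorm : 0 < ‖x‖ := norm_pos_iff.2 hx0
  have horth : ⟪x, f (‖x‖⁻¹ • x)⟫ = 0 := by
    have := htangent _ (hsph x hx0)
    rw [real_inner_smul_left] at this
    exact (mul_eq_zero.1 this).resolve_left (inv_ne_zero hnorm.ne')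
  have ha : min 1 (max 0 (‖x‖ - 1)) = 0 := by
    have h := congrArg (fun z => ⟪x, z⟫) hHx
    simp only [H, inner_add_right, real_inner_smul_right, horth, inner_zero_right, mul_zero,
      add_zero] at h
    exact (mul_eq_zero.1 h).resolve_right (by simpa using hx0)
  have hx1 : ‖x‖ ≤ 1 := by
    by_contra! hlt
    have : 0 < min 1 (max 0 (‖x‖ - 1)) := lt_min one_pos (lt_max_of_lt_right (by linarith))
    exact this.ne' ha
  have hHx' : max 0 (2 - ‖x‖) • f (‖x‖⁻¹ • x) = 0 := by
    simpa only [H, ha, zero_smul, zero_add] using hHx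
  refine (smul_eq_zero.1 hHx').resolve_left (ne_of_gt (lt_max_of_lt_right (by linarith)))
end

section
/- Let N : ℝⁿ → ℝ^{n×n} be a linear map satisfying xᵀN(x)x = 0 for all x ∈ ℝⁿ. Then there exists a nonzero vector z ∈ ℝⁿ with N(z)z = 0, and moreover N(αz)(αz) = 0 for every scalar α. -/
open Matrix

section TangentFields

open MeasureTheory Metric Set Filter Topology

variable {E : Type*} [NormedAddCommGroup E] [InnerProductSpace ℝ E]

/-- The compact annulus `1 ≤ ‖x‖ ≤ 2`. -/
abbrev annulus (E : Type*) [NormedAddCommGroup E] : Set E := {x | 1 ≤ ‖x‖ ∧ ‖x‖ ≤ 2}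

theorem ne_zero_of_mem_annulus {E : Type*} [NormedAddCommGroup E] {x : E} (hx : x ∈ annulus E) :
    x ≠ 0 := by
  rintro rfl
  have := hx.1
  norm_num at this

/-- The map moving `x` by the angle `θ` in the direction `v x`. -/
noncomputable def rotateAlong (v : E → E) (θ : ℝ) (x : E) : E :=
  Real.cos θ • x + Real.sin θ • v x

/-- The derivative of `rotateAlong v θ`. -/
noncomputable def rotateAlongDeriv (v : E → E) (θ : ℝ) (x : E) : E →L[ℝ] E :=
  Real.cos θ • ContinuousLinearMap.id ℝ E + Real.sin θ • fderiv ℝ v x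

theorem isCompact_annulus [FiniteDimensional ℝ E] : IsCompact (annulus E) := by
  have : ProperSpace E := FiniteDimensional.proper ℝ E
  refine (isCompact_closedBall (0 : E) 2).of_isClosed_subset ?_ fun x hx => by simpa using hx.2
  exact (isClosed_le continuous_const continuous_norm).inter
    (isClosed_le continuous_norm continuous_const)

theorem norm_rotateAlong {v : E → E} (hnorm : ∀ x, ‖v x‖ = ‖x‖)
    (horth : ∀ x, inner ℝ x (v x) = 0) (θ : ℝ) (x : E) : ‖rotateAlong v θ x‖ = ‖x‖ := by
  rw [← sq_eq_sq₀ (norm_nonneg _) (norm_nonneg _), rotateAlong, norm_add_sq_real, norm_smul,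
    norm_smul, hnorm, inner_smul_left, inner_smul_right, horth, mul_pow, mul_pow, Real.norm_eq_abs,
    Real.norm_eq_abs, sq_abs, sq_abs]
  linear_combination ‖x‖ ^ 2 * Real.sin_sq_add_cos_sq θ

theorem rotateAlong_bijective [CompleteSpace E] {v : E → E} {C : NNReal} (hv : LipschitzWith C v)
    {θ : ℝ} (hcos : Real.cos θ ≠ 0) (hθ : ‖Real.tan θ‖₊ * C < 1) :
    Function.Bijective (rotateAlong v θ) := by
  rw [Function.bijective_iff_existsUnique]
  intro y
  have hcon : ContractingWith (‖Real.tan θ‖₊ * C)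
      fun x => (Real.cos θ)⁻¹ • y - Real.tan θ • v x := by
    refine ⟨hθ, ?_⟩
    have h := (LipschitzWith.const ((Real.cos θ)⁻¹ • y)).sub
      ((lipschitzWith_smul (Real.tan θ)).comp hv)
    simpa using h
  have key : ∀ x, rotateAlong v θ x = y ↔
      Function.IsFixedPt (fun x => (Real.cos θ)⁻¹ • y - Real.tan θ • v x) x := by
    intro x
    rw [Function.IsFixedPt, sub_eq_iff_eq_add, inv_smul_eq_iff₀ hcos, rotateAlong, smul_add,
      smul_smul, mul_comm, Real.tan_mul_cos hcos, eq_comm]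
  exact ⟨_, (key _).2 hcon.fixedPoint_isFixedPt, fun z hz => hcon.fixedPoint_unique ((key z).1 hz)⟩

theorem eventually_bijOn_rotateAlong [CompleteSpace E] {v : E → E} {C : NNReal}
    (hv : LipschitzWith C v) (hnorm : ∀ x, ‖v x‖ = ‖x‖) (horth : ∀ x, inner ℝ x (v x) = 0) :
    ∀ᶠ θ in 𝓝 (0 : ℝ), BijOn (rotateAlong v θ) (annulus E) (annulus E) := by
  have h1 : ∀ᶠ θ in 𝓝 (0 : ℝ), Real.cos θ ≠ 0 :=
    Real.continuous_cos.continuousAt.eventually_ne (by simp)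
  have h2 : ∀ᶠ θ in 𝓝 (0 : ℝ), ‖Real.tan θ‖₊ * C < 1 := by
    have : ContinuousAt Real.tan 0 := Real.continuousAt_tan.2 (by simp)
    have h : ContinuousAt (fun θ => ‖Real.tan θ‖₊ * C) 0 := this.nnnorm.mul continuousAt_const
    exact h.eventually_lt continuousAt_const (by simp)
  filter_upwards [h1, h2] with θ hθ1 hθ2
  have hb := rotateAlong_bijective hv hθ1 hθ2
  refine ⟨fun x hx => ?_, hb.1.injOn, fun y hy => ?_⟩
  · simpa only [annulus, mem_ofPred_eq, norm_rotateAlong hnorm horth] using hx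
  · obtain ⟨x, rfl⟩ := hb.2 y
    exact ⟨x, by simpa only [annulus, mem_ofPred_eq, norm_rotateAlong hnorm horth] using hy, rfl⟩

theorem hasFDerivAt_rotateAlong {v : E → E} {x : E} (hv : DifferentiableAt ℝ v x) (θ : ℝ) :
    HasFDerivAt (rotateAlong v θ) (rotateAlongDeriv v θ x) x :=
  ((hasFDerivAt_id x).const_smul _).add (hv.hasFDerivAt.const_smul _)

theorem continuousAt_fderiv {v : E → E} {x : E} (hv : ContDiffAt ℝ 1 v x) :
    ContinuousAt (fderiv ℝ v) x :=
  (hv.fderiv_right (m := 0) (by simp)).continuousAt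

variable [FiniteDimensional ℝ E]

theorem eventually_det_rotateAlongDeriv_pos {v : E → E} (hv : ∀ x ≠ 0, ContDiffAt ℝ 1 v x) :
    ∀ᶠ θ in 𝓝 (0 : ℝ), ∀ x ∈ annulus E, 0 < (rotateAlongDeriv v θ x).det := by
  refine isCompact_annulus.eventually_forall_of_forall_eventually fun x hx => ?_
  have hd : ContinuousAt (fun z : ℝ × E => fderiv ℝ v z.2) (0, x) :=
    (continuousAt_fderiv (hv x (ne_zero_of_mem_annulus hx))).comp continuousAt_snd
  have hc : ContinuousAt (fun z : ℝ × E => (rotateAlongDeriv v z.1 z.2).det) (0, x) := by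
    refine ContinuousLinearMap.continuous_det.continuousAt.comp ?_
    exact ((Real.continuous_cos.comp continuous_fst).continuousAt.smul continuousAt_const).add
      ((Real.continuous_sin.comp continuous_fst).continuousAt.smul hd)
  refine continuousAt_const.eventually_lt hc ?_
  simp [rotateAlongDeriv, ContinuousLinearMap.det]

variable [MeasurableSpace E] [BorelSpace E]

theorem eventually_integral_rotateAlong {v : E → E} {C : NNReal}
    (hlip : LipschitzWith C v) (hnorm : ∀ x, ‖v x‖ = ‖x‖) (horth : ∀ x, inner ℝ x (v x) = 0)
    (hv : ∀ x ≠ 0, ContDiffAt ℝ 1 v x) :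
    ∀ᶠ θ in 𝓝 (0 : ℝ), ∀ φ : E → ℝ,
      ∫ x in annulus E, φ (rotateAlong v θ x) * (rotateAlongDeriv v θ x).det =
        ∫ x in annulus E, φ x := by
  have : CompleteSpace E := FiniteDimensional.complete ℝ E
  filter_upwards [eventually_bijOn_rotateAlong hlip hnorm horth,
    eventually_det_rotateAlongDeriv_pos hv] with θ hb hpos φ
  have hm : MeasurableSet (annulus E) := isCompact_annulus.measurableSet
  have h := integral_image_eq_integral_abs_det_fderiv_smul volume hm
    (fun x hx => (hasFDerivAt_rotateAlong
      ((hv x (ne_zero_of_mem_annulus hx)).differentiableAt (by simp)) θ).hasFDerivWithinAt)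
    hb.injOn φ
  rw [hb.image_eq] at h
  rw [h]
  refine setIntegral_congr_fun hm fun x hx => ?_
  simp only [abs_of_pos (hpos x hx), smul_eq_mul, mul_comm]

/-- Integration against a finite measure, as a continuous linear functional on `C(X, ℝ)`. -/
noncomputable def integralFunctional {X : Type*} [TopologicalSpace X] [CompactSpace X]
    [MeasurableSpace X] [BorelSpace X] (μ : Measure X) [IsFiniteMeasure μ] : C(X, ℝ) →L[ℝ] ℝ :=
  LinearMap.mkContinuous
    { toFun := fun f => ∫ x, f x ∂μ
      map_add' := fun f g => integral_add
        (f.continuous.integrable_of_hasCompactSupport (.of_compactSpace _))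
        (g.continuous.integrable_of_hasCompactSupport (.of_compactSpace _))
      map_smul' := fun c f => integral_const_mul c _ }
    (μ.real univ) fun f => by
      rw [mul_comm]
      exact norm_integral_le_of_norm_le_const (Eventually.of_forall fun x => f.norm_coe_le_norm x)

/-- The functions `φ` on `Y` whose pullbacks along the family `g θ : X → Y` are analytic in `θ`. -/
noncomputable def analyticPullback {X Y : Type*} [TopologicalSpace X] [CompactSpace X]
    [TopologicalSpace Y] (g : ℝ → C(X, Y)) : Subalgebra ℝ C(Y, ℝ) where
  carrier := {φ | AnalyticOnNhd ℝ (fun θ => φ.comp (g θ)) univ}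
  mul_mem' hφ hψ := hφ.mul hψ
  add_mem' hφ hψ := hφ.add hψ
  algebraMap_mem' c := show AnalyticOnNhd ℝ (fun _ => algebraMap ℝ C(X, ℝ) c) univ from
    analyticOnNhd_const

theorem analyticAt_matrix_det {A ι : Type*} [NormedCommRing A] [NormedAlgebra ℝ A] [Fintype ι]
    [DecidableEq ι] {M : ℝ → Matrix ι ι A} {θ : ℝ} (hM : ∀ i j, AnalyticAt ℝ (fun t => M t i j) θ) :
    AnalyticAt ℝ (fun t => (M t).det) θ := by
  simp only [det_apply']
  exact Finset.analyticAt_fun_sum _ fun σ _ =>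
    analyticAt_const.mul (Finset.analyticAt_fun_prod _ fun i _ => hM _ _)

theorem analyticAt_cos_smul_add_sin_smul {F : Type*} [NormedAddCommGroup F] [NormedSpace ℝ F]
    (a b : F) (θ : ℝ) : AnalyticAt ℝ (fun t => Real.cos t • a + Real.sin t • b) θ :=
  (Real.analyticAt_cos.smul analyticAt_const).add (Real.analyticAt_sin.smul analyticAt_const)

theorem integral_comp_mul_det_fderiv {v : E → E} {C : NNReal}
    (hlip : LipschitzWith C v) (hnorm : ∀ x, ‖v x‖ = ‖x‖) (horth : ∀ x, inner ℝ x (v x) = 0)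
    (hv : ∀ x ≠ 0, ContDiffAt ℝ 1 v x) {φ : E → ℝ} (hφ : Continuous φ) :
    ∫ x in annulus E, φ (v x) * (fderiv ℝ v x).det = ∫ x in annulus E, φ x := by
  have hcomp : CompactSpace (annulus E) := isCompact_iff_compactSpace.1 isCompact_annulus
  have hmeas : MeasurableSet (annulus E) := isCompact_annulus.measurableSet
  let μ : Measure (annulus E) := (volume : Measure E).comap (↑)
  have hμ : IsFiniteMeasure μ := ⟨by
    rw [← lintegral_one, lintegral_subtype_comap hmeas fun _ => 1, setLIntegral_one]
    exact isCompact_annulus.measure_lt_top⟩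
  have hdv : ContinuousOn (fderiv ℝ v) (annulus E) := fun x hx =>
    (continuousAt_fderiv (hv x (ne_zero_of_mem_annulus hx))).continuousWithinAt
  let ι := Fin (Module.finrank ℝ E)
  let b : OrthonormalBasis ι ℝ E := stdOrthonormalBasis ℝ E
  have hmaps : ∀ θ (x : annulus E), rotateAlong v θ x ∈ annulus E := fun θ x => by
    have := x.2
    simpa only [annulus, mem_ofPred_eq, norm_rotateAlong hnorm horth] using this
  have hcont : ∀ θ, Continuous fun x : annulus E => rotateAlong v θ x := fun θ => by
    have := hlip.continuous
    unfold rotateAlong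
    fun_prop
  let g : ℝ → C(annulus E, annulus E) := fun θ =>
    ⟨fun x => ⟨rotateAlong v θ x, hmaps θ x⟩, (hcont θ).subtype_mk (hmaps θ)⟩
  let D : ℝ → C(annulus E, ℝ) := fun θ =>
    ⟨fun x => (rotateAlongDeriv v θ x).det, by
      refine ContinuousLinearMap.continuous_det.comp ?_
      exact continuous_const.add (hdv.domRestrict.const_smul (Real.sin θ))⟩
  let M : Matrix ι ι C(annulus E, ℝ) := fun i j =>
    ⟨fun x => inner ℝ (b i) (fderiv ℝ v x (b j)),
      continuous_const.inner (hdv.domRestrict.clm_apply continuous_const)⟩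
  have hD : AnalyticOnNhd ℝ D univ := by
    have hDM : D = fun θ => (Real.cos θ • (1 : Matrix ι ι C(annulus E, ℝ)) +
        Real.sin θ • M).det := by
      funext θ
      ext x
      let ev : C(annulus E, ℝ) →+* ℝ := (ContinuousMap.evalAlgHom ℝ ℝ x).toRingHom
      change (rotateAlongDeriv v θ x).det = ev _
      rw [ContinuousLinearMap.det, ← LinearMap.det_toMatrix b.toBasis, RingHom.map_det]
      congr 1
      ext i j
      have hM : inner ℝ (b i) (fderiv ℝ v x (b j)) = M i j x := rfl
      obtain rfl | hij := eq_or_ne i j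
      · simp [LinearMap.toMatrix_apply, rotateAlongDeriv, ev, hM, b.repr_apply_apply]
      · simp [LinearMap.toMatrix_apply, rotateAlongDeriv, ev, hM, b.repr_apply_apply, hij]
    rw [hDM]
    exact fun θ _ => analyticAt_matrix_det fun i j =>
      analyticAt_cos_smul_add_sin_smul ((1 : Matrix ι ι C(annulus E, ℝ)) i j) (M i j) θ
  have hsep : (analyticPullback g).SeparatesPoints := by
    intro x y hxy
    let ψ : C(annulus E, ℝ) := ⟨fun z => inner ℝ ((x : E) - y) z, by fun_prop⟩
    refine ⟨ψ, ⟨ψ, ?_, rfl⟩, fun h => hxy (Subtype.ext ?_)⟩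
    · let ψ' : C(annulus E, ℝ) := ⟨fun z => inner ℝ ((x : E) - y) (v z), by
        have := hlip.continuous
        fun_prop⟩
      have : (fun θ => ψ.comp (g θ)) = fun θ => Real.cos θ • ψ + Real.sin θ • ψ' := by
        funext θ
        ext z
        simp [ψ, ψ', g, rotateAlong, inner_add_right, inner_smul_right]
      change AnalyticOnNhd ℝ (fun θ => ψ.comp (g θ)) univ
      rw [this]
      exact fun θ _ => analyticAt_cos_smul_add_sin_smul ψ ψ' θ
    · change inner ℝ ((x : E) - y) (x : E) = inner ℝ ((x : E) - y) (y : E) at h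
      rwa [← sub_eq_zero, ← inner_sub_right, inner_self_eq_zero, sub_eq_zero] at h
  have hsub : (analyticPullback g : Set C(annulus E, ℝ)) ⊆
      {ψ | integralFunctional μ (ψ.comp (g (Real.pi / 2)) * D (Real.pi / 2)) =
        integralFunctional μ ψ} := by
    intro ψ hψ
    have han : AnalyticOnNhd ℝ (fun θ => integralFunctional μ (ψ.comp (g θ) * D θ)) univ :=
      (integralFunctional μ).comp_analyticOnNhd (AnalyticOnNhd.mul hψ hD)
    have heq := han.eq_of_eventuallyEq (g := fun _ => integralFunctional μ ψ) (z₀ := 0)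
      analyticOnNhd_const ?_
    · exact congrFun heq _
    · filter_upwards [eventually_integral_rotateAlong hlip hnorm horth hv] with θ hθ
      obtain ⟨Φ, hΦ⟩ : ∃ Φ : E → ℝ, ∀ z : annulus E, Φ z = ψ z :=
        ⟨fun z => open Classical in if h : z ∈ annulus E then ψ ⟨z, h⟩ else 0, fun z => by simp⟩
      have h := hθ Φ
      rw [← integral_subtype_comap hmeas, ← integral_subtype_comap hmeas] at h
      simp only [hΦ] at h
      refine Eq.trans (integral_congr_ae (.of_forall fun z => ?_)) h
      exact congrArg (· * _) (hΦ (g θ z)).symm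
  have hclosed : IsClosed {ψ : C(annulus E, ℝ) |
      integralFunctional μ (ψ.comp (g (Real.pi / 2)) * D (Real.pi / 2)) =
        integralFunctional μ ψ} := by
    refine isClosed_eq ((integralFunctional μ).continuous.comp ?_) (integralFunctional μ).continuous
    exact (ContinuousMap.continuous_precomp _).mul continuous_const
  have hall := hclosed.closure_subset_iff.2 hsub
  have hmem : (⟨fun x => φ x, by fun_prop⟩ : C(annulus E, ℝ)) ∈
      (analyticPullback g).topologicalClosure := by
    rw [ContinuousMap.subalgebra_topologicalClosure_eq_top_of_separatesPoints _ hsep]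
    trivial
  have h := hall hmem
  rw [← integral_subtype_comap hmeas, ← integral_subtype_comap hmeas]
  change ∫ x : annulus E, φ (rotateAlong v (Real.pi / 2) x) *
    (rotateAlongDeriv v (Real.pi / 2) x).det ∂μ = ∫ x : annulus E, φ x ∂μ at h
  simp only [rotateAlong, rotateAlongDeriv, Real.cos_pi_div_two, Real.sin_pi_div_two, zero_smul,
    one_smul, zero_add] at h
  exact h

theorem exists_isOpen_integral_eq_sign_mul {f : E → E} {x : E} (hf : ContDiffAt ℝ 1 f x)
    (hdet : (fderiv ℝ f x).det ≠ 0) {W : Set E} (hW : W ∈ 𝓝 x) :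
    ∃ U ⊆ W, IsOpen U ∧ x ∈ U ∧ InjOn f U ∧ f '' U ∈ 𝓝 (f x) ∧ ∀ φ : E → ℝ,
      ∫ z in U, φ (f z) * (fderiv ℝ f z).det =
        ((SignType.sign (fderiv ℝ f x).det : ℤ) : ℝ) * ∫ z in f '' U, φ z := by
  have : CompleteSpace E := FiniteDimensional.complete ℝ E
  have hdetc : ContinuousAt (fun z => (fderiv ℝ f z).det) x :=
    ContinuousLinearMap.continuous_det.continuousAt.comp (continuousAt_fderiv hf)
  have hsign : ∀ᶠ z in 𝓝 x,
      SignType.sign (fderiv ℝ f z).det = SignType.sign (fderiv ℝ f x).det := by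
    rcases hdet.lt_or_gt with h | h
    · filter_upwards [hdetc.eventually_lt continuousAt_const h] with z hz
      rw [sign_neg h, sign_neg hz]
    · filter_upwards [continuousAt_const.eventually_lt hdetc h] with z hz
      rw [sign_pos h, sign_pos hz]
  let A := (fderiv ℝ f x).toContinuousLinearEquivOfDetNeZero hdet
  have hstrict : HasStrictFDerivAt f (A : E →L[ℝ] E) x := hf.hasStrictFDerivAt (by simp)
  let e := hstrict.toOpenPartialHomeomorph f
  have hsource : e.source ∈ 𝓝 x :=
    e.open_source.mem_nhds hstrict.mem_toOpenPartialHomeomorph_source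
  obtain ⟨U, hU, hUo, hxU⟩ := _root_.mem_nhds_iff.1
    (inter_mem (inter_mem hW hsource) (hsign.and (hf.eventually (by simp))))
  have hinj : InjOn f U := e.injOn.mono fun z hz => (hU hz).1.2
  refine ⟨U, fun z hz => (hU hz).1.1, hUo, hxU, hinj, ?_, fun φ => ?_⟩
  · rw [← hstrict.map_nhds_eq_of_equiv]
    exact image_mem_map (hUo.mem_nhds hxU)
  · rw [integral_image_eq_integral_abs_det_fderiv_smul volume hUo.measurableSet
      (fun z hz => ((hU hz).2.2.differentiableAt (by simp)).hasFDerivAt.hasFDerivWithinAt) hinj,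
      ← integral_const_mul]
    refine setIntegral_congr_fun hUo.measurableSet fun z hz => ?_
    have h : ((SignType.sign (fderiv ℝ f z).det : ℤ) : ℝ) * |(fderiv ℝ f z).det| =
        (fderiv ℝ f z).det := by
      simp
    simp only [← (hU hz).2.1, smul_eq_mul]
    linear_combination -φ (f z) * h

theorem exists_finset_integral_eq_sum_sign_mul {f : E → E} {K : Set E} {y : E} (hK : IsCompact K)
    (hf : ∀ x ∈ K, ContDiffAt ℝ 1 f x)
    (hy : ∀ x ∈ K, f x = y → x ∈ interior K ∧ (fderiv ℝ f x).det ≠ 0) :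
    ∃ S : Finset E, (∀ x, x ∈ S ↔ x ∈ K ∧ f x = y) ∧ ∃ V ∈ 𝓝 y, ∀ φ : E → ℝ, Continuous φ →
      Function.support φ ⊆ V → ∫ x in K, φ (f x) * (fderiv ℝ f x).det =
        ((∑ x ∈ S, (SignType.sign (fderiv ℝ f x).det : ℤ) : ℤ) : ℝ) * ∫ x, φ x := by
  have hfc : ContinuousOn f K := fun x hx => (hf x hx).continuousAt.continuousWithinAt
  have hfin : (K ∩ f ⁻¹' {y}).Finite := by
    have hcomp : IsCompact (K ∩ f ⁻¹' {y}) :=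
      hK.of_isClosed_subset (hfc.preimage_isClosed_of_isClosed hK.isClosed isClosed_singleton)
        inter_subset_left
    have hloc : ∀ x ∈ K ∩ f ⁻¹' {y}, ∃ U ∈ 𝓝 x, InjOn f U := fun x hx => by
      obtain ⟨U, -, hUo, hxU, hinj, -⟩ :=
        exists_isOpen_integral_eq_sign_mul (hf x hx.1) (hy x hx.1 hx.2).2 univ_mem
      exact ⟨U, hUo.mem_nhds hxU, hinj⟩
    choose! U hU hinj using hloc
    obtain ⟨t, ht, hsub⟩ := hcomp.elim_nhds_subcover U hU
    refine t.finite_toSet.subset fun x hx => ?_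
    obtain ⟨z, hz, hxz⟩ := mem_iUnion₂.1 (hsub hx)
    rwa [hinj z (ht z hz) hxz (mem_of_mem_nhds (hU z (ht z hz))) (hx.2.trans (ht z hz).2.symm)]
  have hS : ∀ x, x ∈ hfin.toFinset ↔ x ∈ K ∧ f x = y := fun x => by simp
  refine ⟨hfin.toFinset, hS, ?_⟩
  obtain ⟨W, hW, hdisj⟩ := hfin.t2_separation
  have hloc : ∀ x ∈ hfin.toFinset, ∃ U ⊆ W x ∩ interior K, IsOpen U ∧ x ∈ U ∧ f '' U ∈ 𝓝 y ∧
      ∀ φ : E → ℝ, ∫ z in U, φ (f z) * (fderiv ℝ f z).det =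
        ((SignType.sign (fderiv ℝ f x).det : ℤ) : ℝ) * ∫ z in f '' U, φ z := fun x hx => by
    obtain ⟨hxK, rfl⟩ := (hS x).1 hx
    obtain ⟨hint, hdet⟩ := hy x hxK rfl
    obtain ⟨U, h1, h2, h3, -, h4, h5⟩ := exists_isOpen_integral_eq_sign_mul (hf x hxK) hdet
      (inter_mem ((hW x).2.mem_nhds (hW x).1) (isOpen_interior.mem_nhds hint))
    exact ⟨U, h1, h2, h3, h4, h5⟩
  choose! U hUsub hUo hxU hUy hUint using hloc
  have hUK : ⋃ x ∈ hfin.toFinset, U x ⊆ K :=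
    iUnion₂_subset fun x hx => (hUsub x hx).trans (inter_subset_right.trans interior_subset)
  have hUnion : IsOpen (⋃ x ∈ hfin.toFinset, U x) := isOpen_biUnion hUo
  have hrest : IsCompact (f '' (K \ ⋃ x ∈ hfin.toFinset, U x)) :=
    (hK.diff hUnion).image_of_continuousOn (hfc.mono sdiff_subset)
  refine ⟨(⋂ x ∈ hfin.toFinset, f '' U x) ∩ (f '' (K \ ⋃ x ∈ hfin.toFinset, U x))ᶜ,
    inter_mem ((Filter.biInter_finset_mem _).2 hUy) (hrest.isClosed.isOpen_compl.mem_nhds ?_), ?_⟩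
  · rintro ⟨x, hx, hxy⟩
    have hxS := (hS x).2 ⟨hx.1, hxy⟩
    exact hx.2 (mem_iUnion₂.2 ⟨x, hxS, hxU x hxS⟩)
  intro φ hφ hsupp
  have hcont : ContinuousOn (fun x => φ (f x) * (fderiv ℝ f x).det) K :=
    (hφ.comp_continuousOn hfc).mul (ContinuousLinearMap.continuous_det.comp_continuousOn
      fun x hx => (continuousAt_fderiv (hf x hx)).continuousWithinAt)
  have hinteg := hcont.integrableOn_compact hK (μ := volume)
  have hzero : ∀ x ∈ K \ ⋃ x ∈ hfin.toFinset, U x, φ (f x) * (fderiv ℝ f x).det = 0 := by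
    intro x hx
    have : φ (f x) = 0 := by
      by_contra hne
      exact (hsupp hne).2 (mem_image_of_mem f hx)
    rw [this, zero_mul]
  rw [setIntegral_eq_of_subset_of_forall_sdiff_eq_zero hK.measurableSet hUK hzero,
    integral_biUnion_finset _ (fun x hx => (hUo x hx).measurableSet)
      (fun a ha b hb hab => (hdisj (by simpa using ha) (by simpa using hb) hab).mono
        ((hUsub a ha).trans inter_subset_left) ((hUsub b hb).trans inter_subset_left))
      (fun x hx => hinteg.mono_set ((subset_biUnion_of_mem (u := U) hx).trans hUK)),
    Int.cast_sum, Finset.sum_mul]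
  refine Finset.sum_congr rfl fun x hx => ?_
  rw [hUint x hx, setIntegral_eq_integral_of_forall_compl_eq_zero]
  intro z hz
  by_contra hne
  exact hz (mem_iInter₂.1 (hsupp hne).1 x hx)

/-- A norm-preserving vector field tangent to the spheres centred at the origin is not even. -/
theorem not_even_of_inner_eq_zero [Nontrivial E] {v : E → E} {C : NNReal}
    (hlip : LipschitzWith C v) (hnorm : ∀ x, ‖v x‖ = ‖x‖) (horth : ∀ x, inner ℝ x (v x) = 0)
    (hv : ∀ x ≠ 0, ContDiffAt ℝ 1 v x) : ¬ ∀ x, v (-x) = v x := by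
  intro heven
  have hopen : IsOpen {x : E | 1 < ‖x‖ ∧ ‖x‖ < 2} :=
    (isOpen_lt continuous_const continuous_norm).inter (isOpen_lt continuous_norm continuous_const)
  have hsub : {x : E | 1 < ‖x‖ ∧ ‖x‖ < 2} ⊆ annulus E := fun x hx => ⟨hx.1.le, hx.2.le⟩
  obtain ⟨y, hyO, hycrit⟩ : ∃ y ∈ {x : E | 1 < ‖x‖ ∧ ‖x‖ < 2},
      y ∉ v '' {x | x ∈ annulus E ∧ (fderiv ℝ v x).det = 0} := by
    by_contra! h
    have hnull := addHaar_image_eq_zero_of_det_fderivWithin_eq_zero (volume : Measure E)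
      (s := {x | x ∈ annulus E ∧ (fderiv ℝ v x).det = 0})
      (fun x hx => ((hv x (ne_zero_of_mem_annulus hx.1)).differentiableAt
        (by simp)).hasFDerivAt.hasFDerivWithinAt) fun x hx => hx.2
    obtain ⟨z, hz⟩ := exists_norm_eq E (c := 3 / 2) (by norm_num)
    refine (hopen.measure_pos volume ⟨z, ?_⟩).ne' (measure_mono_null h hnull)
    constructor <;> rw [hz] <;> norm_num
  obtain ⟨S, hS, V, hV, hint⟩ := exists_finset_integral_eq_sum_sign_mul (y := y) isCompact_annulus
    (fun x hx => hv x (ne_zero_of_mem_annulus hx)) fun x hx hxy => by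
      refine ⟨interior_maximal hsub hopen ?_, fun h => hycrit ⟨x, ⟨hx, h⟩, hxy⟩⟩
      simpa only [← hxy, mem_ofPred_eq, hnorm] using hyO
  obtain ⟨r, hr, hball⟩ := Metric.mem_nhds_iff.1 (inter_mem hV (hopen.mem_nhds hyO))
  let φ : ContDiffBump y := ⟨r / 2, r, half_pos hr, half_lt_self hr⟩
  have hsupp : Function.support φ ⊆ ball y r := φ.support_eq.subset
  have h := integral_comp_mul_det_fderiv hlip hnorm horth hv φ.continuous
  rw [hint φ φ.continuous (hsupp.trans (hball.trans inter_subset_left)),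
    setIntegral_eq_integral_of_forall_compl_eq_zero fun x hx => by
      by_contra hne
      exact hx (hsub (hball (hsupp hne)).2)] at h
  have hone : ∑ x ∈ S, (SignType.sign (fderiv ℝ v x).det : ℤ) = 1 := by
    exact_mod_cast mul_right_cancel₀ φ.integral_pos.ne' (h.trans (one_mul _).symm)
  have hcast : ∑ x ∈ S, (1 : ZMod 2) = 1 := by
    refine Eq.trans ?_ ((congrArg (Int.cast (R := ZMod 2)) hone).trans Int.cast_one)
    rw [Int.cast_sum]
    refine Finset.sum_congr rfl fun x hx => ?_
    obtain ⟨hxK, hxy⟩ := (hS x).1 hx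
    have hne : (fderiv ℝ v x).det ≠ 0 := fun h => hycrit ⟨x, ⟨hxK, h⟩, hxy⟩
    rcases hne.lt_or_gt with h | h
    · rw [sign_neg h]; decide
    · rw [sign_pos h]; decide
  have hzero : ∑ x ∈ S, (1 : ZMod 2) = 0 := by
    refine Finset.sum_involution (fun x _ => -x) (fun _ _ => by decide) (fun x hx _ => ?_)
      (fun x hx => ?_) fun x _ => neg_neg x
    · intro h
      rw [neg_eq_iff_add_eq_zero, ← two_smul ℝ, smul_eq_zero_iff_right two_ne_zero] at h
      exact ne_zero_of_mem_annulus ((hS x).1 hx).1 h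
    · obtain ⟨hxK, hxy⟩ := (hS x).1 hx
      exact (hS _).2 ⟨by simpa only [annulus, mem_ofPred_eq, norm_neg] using hxK,
        (heven x).trans hxy⟩
  exact zero_ne_one (hzero.symm.trans hcast)

omit [MeasurableSpace E] [BorelSpace E] in
theorem exists_lipschitzWith_of_homogeneous {v : E → E} (hv : ∀ x ≠ 0, ContDiffAt ℝ 1 v x)
    (hnorm : ∀ x, ‖v x‖ = ‖x‖) (hsmul : ∀ r : ℝ, 0 < r → ∀ x, v (r • x) = r • v x) :
    ∃ C, LipschitzWith C v := by
  obtain ⟨C, hC⟩ := (isCompact_annulus (E := E)).exists_bound_of_continuousOn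
    (f := fderiv ℝ v) fun x hx =>
      (continuousAt_fderiv (hv x (ne_zero_of_mem_annulus hx))).continuousWithinAt
  have hbound : ∀ x ≠ 0, ‖fderiv ℝ v x‖ ≤ max C 1 := by
    intro x hx
    have hr : 0 < ‖x‖⁻¹ := inv_pos.2 (norm_pos_iff.2 hx)
    have h1 : ‖‖x‖⁻¹ • x‖ = 1 := norm_smul_inv_norm (𝕜 := ℝ) hx
    have h2 := fderiv_comp_smul (𝕜 := ℝ) (f := v) (x := x) ‖x‖⁻¹
    rw [funext (hsmul _ hr), fderiv_fun_const_smul ((hv x hx).differentiableAt (by simp))] at h2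
    rw [smul_right_injective _ hr.ne' h2]
    exact (hC _ ⟨h1.ge, h1.trans_le one_le_two⟩).trans (le_max_left _ _)
  have h0 : 0 ≤ max C 1 := zero_le_one.trans (le_max_right _ _)
  refine ⟨⟨max C 1, h0⟩, LipschitzWith.of_dist_le_mul fun x y => ?_⟩
  change dist (v x) (v y) ≤ max C 1 * dist x y
  by_cases h : (0 : E) ∈ segment ℝ x y
  · calc dist (v x) (v y) ≤ ‖v x‖ + ‖v y‖ := dist_le_norm_add_norm _ _
      _ = dist x y := by
        rw [hnorm, hnorm, ← dist_add_dist_of_mem_segment h, dist_zero_right, dist_zero_left]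
      _ ≤ max C 1 * dist x y := le_mul_of_one_le_left dist_nonneg (le_max_right _ _)
  · have hne : ∀ z ∈ segment ℝ x y, z ≠ 0 := fun z hz hz0 => h (hz0 ▸ hz)
    rw [dist_eq_norm, dist_eq_norm]
    exact (convex_segment x y).norm_image_sub_le_of_norm_fderiv_le
      (fun z hz => (hv z (hne z hz)).differentiableAt (by simp)) (fun z hz => hbound z (hne z hz))
      (right_mem_segment ℝ x y) (left_mem_segment ℝ x y)

/-- A homogeneous quadratic vector field tangent to the spheres centred at the origin has a
nontrivial zero. -/
theorem exists_ne_zero_of_quadratic_tangent [Nontrivial E] {Q : E → E} (hQ : ContDiff ℝ 1 Q)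
    (hsmul : ∀ (r : ℝ) (x : E), Q (r • x) = r ^ 2 • Q x) (horth : ∀ x, inner ℝ x (Q x) = 0) :
    ∃ x ≠ 0, Q x = 0 := by
  by_contra! hne
  let v : E → E := fun x => (‖x‖ / ‖Q x‖) • Q x
  have hnorm : ∀ x, ‖v x‖ = ‖x‖ := by
    intro x
    rcases eq_or_ne x 0 with rfl | hx
    · simp [v]
    · have := norm_ne_zero_iff.2 (hne x hx)
      simp only [v, norm_smul, norm_div, norm_norm]
      field_simp
  have hv : ∀ x ≠ 0, ContDiffAt ℝ 1 v x := fun x hx =>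
    ((contDiffAt_norm ℝ hx).div (hQ.contDiffAt.norm ℝ (hne x hx))
      (norm_ne_zero_iff.2 (hne x hx))).smul hQ.contDiffAt
  have hv_smul : ∀ r : ℝ, 0 < r → ∀ x, v (r • x) = r • v x := by
    intro r hr x
    simp only [v, hsmul, norm_smul, smul_smul, norm_pow, Real.norm_of_nonneg hr.le]
    congr 1
    field_simp
  obtain ⟨C, hC⟩ := exists_lipschitzWith_of_homogeneous hv hnorm hv_smul
  refine not_even_of_inner_eq_zero hC hnorm (fun x => ?_) hv fun x => ?_
  · simp only [v, inner_smul_right, horth, mul_zero]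
  · have : Q (-x) = Q x := by simpa using hsmul (-1) x
    simp only [v, norm_neg, this]

end TangentFields

/-- For a linear, energy-preserving `N` there is a nonzero `z` with `N(z)z = 0`,
and every scalar multiple of `z` is also a zero of `x ↦ N(x)x`. -/
theorem stmt3 {n : ℕ} (hn : 0 < n)
    (N : (Fin n → ℝ) →ₗ[ℝ] Matrix (Fin n) (Fin n) ℝ)
    (hN : ∀ x : Fin n → ℝ, x ⬝ᵥ (N x).mulVec x = 0) :
    ∃ z : Fin n → ℝ, z ≠ 0 ∧ (N z).mulVec z = 0 ∧
      ∀ α : ℝ, (N (α • z)).mulVec (α • z) = 0 := by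
  have : Nonempty (Fin n) := ⟨⟨0, hn⟩⟩
  have hsmul : ∀ (r : ℝ) (x : Fin n → ℝ), (N (r • x)).mulVec (r • x) = r ^ 2 • (N x).mulVec x := by
    intro r x
    rw [map_smul, smul_mulVec, mulVec_smul, smul_smul, sq]
  have hcoord : ∀ i j, ContDiff ℝ 1 fun x : EuclideanSpace ℝ (Fin n) => N x.ofLp i j := fun i j =>
    (LinearMap.toContinuousLinearMap ((entryLinearMap ℝ ℝ i j ∘ₗ N) ∘ₗ
      (WithLp.linearEquiv 2 ℝ (Fin n → ℝ)).toLinearMap)).contDiff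
  obtain ⟨z, hz, hz0⟩ := exists_ne_zero_of_quadratic_tangent
    (Q := fun x : EuclideanSpace ℝ (Fin n) => WithLp.toLp 2 ((N x.ofLp).mulVec x.ofLp))
    (by
      rw [contDiff_euclidean]
      intro i
      change ContDiff ℝ 1 fun x : EuclideanSpace ℝ (Fin n) => ∑ j, N x.ofLp i j * x.ofLp j
      exact ContDiff.sum fun j _ => (hcoord i j).mul (contDiff_euclidean.1 contDiff_id j))
    (fun r x => by rw [WithLp.ofLp_smul, hsmul, WithLp.toLp_smul])
    (fun x => by simpa [EuclideanSpace.inner_eq_star_dotProduct, dotProduct_comm] using hN x.ofLp)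
  have hz0' : (N z.ofLp).mulVec z.ofLp = 0 := congrArg WithLp.ofLp hz0
  exact ⟨z.ofLp, fun h => hz (WithLp.ofLp_injective 2 h), hz0', fun α => by
    rw [hsmul, hz0', smul_zero]⟩
end
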